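/- arXiv:2110.12446 — 2 statements merged into one kernel-verified Lean document; each statement's English description precedes it below -/
import Mathlib

section
/- Let F be a free group (on any set of generators), let a and b be elements of F, and let l be an integer. If b·(ab)^l = (ab)^l·a, then a = b. -/
/-- A free group with at most one generator is commutative. -/
theorem free_comm_of_subsingleton {H : Type*} [Group H] [IsFreeGroup H]
    (hs : ∀ i j : IsFreeGroup.Generators H, i = j) (x y : H) : x * y = y * x := by
  have h1 : ∀ (i : IsFreeGroup.Generators H) (z : H),
      IsFreeGroup.of i * z * (IsFreeGroup.of i)⁻¹ = z := by
    intro i z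
    have : (MulAut.conj (IsFreeGroup.of i : H)).toMonoidHom = MonoidHom.id H := by
      apply IsFreeGroup.ext_hom
      intro j
      rw [hs j i]
      simp
    simpa using DFunLike.congr_fun this z
  have : (MulAut.conj x).toMonoidHom = MonoidHom.id H := by
    apply IsFreeGroup.ext_hom
    intro j
    have := h1 j x
    simp only [MulEquiv.toMonoidHom_eq_coe, MonoidHom.coe_coe, MulAut.conj_apply,
      MonoidHom.id_apply]
    rw [mul_inv_eq_iff_eq_mul] at this ⊢
    exact this.symm
  have h2 : x * y * x⁻¹ = y := by simpa using DFunLike.congr_fun this y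
  exact mul_inv_eq_iff_eq_mul.1 h2

/-- In a free group, if `b * (a*b)^l = (a*b)^l * a` for some integer `l`, then `a = b`. -/
theorem free_group_rel_zpow_imp_eq {X : Type*} (a b : FreeGroup X) (l : ℤ)
    (h : b * (a * b) ^ l = (a * b) ^ l * a) : a = b := by
  classical
  let H : Subgroup (FreeGroup X) := Subgroup.closure {a, b}
  have ha : a ∈ H := Subgroup.subset_closure (by simp)
  have hb : b ∈ H := Subgroup.subset_closure (by simp)
  let a' : H := ⟨a, ha⟩
  let b' : H := ⟨b, hb⟩
  have h' : b' * (a' * b') ^ l = (a' * b') ^ l * a' := Subtype.ext (by simpa using h)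
  have key : ∀ (φ : H →* Multiplicative (ℤ × ℤ)) (x : FreeGroup X) (hx : x ∈ H),
      φ ⟨x, hx⟩ ∈ Subgroup.zpowers (φ a') := by
    intro φ x hx
    have hab : φ b' = φ a' := by
      have := congrArg φ h'
      rw [map_mul, map_mul, mul_comm] at this
      exact mul_left_cancel this
    induction hx using Subgroup.closure_induction with
    | mem x hx =>
      rcases hx with rfl | rfl
      · exact Subgroup.mem_zpowers _
      · change φ b' ∈ _
        rw [hab]
        exact Subgroup.mem_zpowers _
    | one => exact (map_one φ) ▸ one_mem _
    | mul x y hx hy h1 h2 =>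
      have := mul_mem h1 h2
      rwa [← map_mul] at this
    | inv x hx h1 =>
      have := inv_mem h1
      rwa [← map_inv] at this
  have hs : ∀ i j : IsFreeGroup.Generators H, i = j := by
    intro i j
    by_contra hij
    let f : IsFreeGroup.Generators H → Multiplicative (ℤ × ℤ) := fun k =>
      if k = i then Multiplicative.ofAdd (1, 0) else Multiplicative.ofAdd (0, 1)
    let φ : H →* Multiplicative (ℤ × ℤ) := IsFreeGroup.lift f
    have hi := key φ (IsFreeGroup.of i : H).1 (IsFreeGroup.of i : H).2
    have hj := key φ (IsFreeGroup.of j : H).1 (IsFreeGroup.of j : H).2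
    have ei : φ (IsFreeGroup.of i) = Multiplicative.ofAdd (1, 0) := by
      simp [φ, f]
    have ej : φ (IsFreeGroup.of j) = Multiplicative.ofAdd (0, 1) := by
      simp [φ, f, Ne.symm hij]
    rw [Subtype.coe_eta, ei] at hi
    rw [Subtype.coe_eta, ej] at hj
    obtain ⟨m, hm⟩ := hi
    obtain ⟨n, hn⟩ := hj
    have hm' : m • (φ a').toAdd = ((1, 0) : ℤ × ℤ) := hm
    have hn' : n • (φ a').toAdd = ((0, 1) : ℤ × ℤ) := hn
    generalize (φ a').toAdd = v at hm' hn'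
    obtain ⟨p, q⟩ := v
    simp only [Prod.smul_mk, smul_eq_mul, Prod.mk.injEq] at hm' hn'
    obtain ⟨h1, h2⟩ := hm'
    obtain ⟨h3, h4⟩ := hn'
    have : (1 : ℤ) = 0 := by
      calc (1 : ℤ) = (m * p) * (n * q) := by rw [h1, h4]; rfl
        _ = (m * q) * (n * p) := by ring
        _ = 0 := by rw [h2]; simp
    exact one_ne_zero this
  have hc := free_comm_of_subsingleton hs ((a' * b') ^ l) a'
  rw [hc] at h'
  exact (congrArg Subtype.val (mul_right_cancel h')).symm
end

section
/- Let F be a free group, let a and b be elements of F, and set κ = a·b. Then there exists an integer l with κ^l · a · κ^{-l} = b if and only if κ = a². -/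
/-- In a free group, with `κ = a * b`, there exists an integer `l` with
`κ^l * a * κ^(-l) = b` if and only if `κ = a^2`. -/
theorem free_group_conj_zpow_iff_sq {X : Type*} (a b κ : FreeGroup X) (hκ : κ = a * b) :
    (∃ l : ℤ, κ ^ l * a * κ ^ (-l) = b) ↔ κ = a ^ 2 := by
  constructor
  · rintro ⟨l, hl⟩
    have h1 : κ ^ l * a = b * κ ^ l := by
      rw [← hl, zpow_neg, inv_mul_cancel_right]
    have hx : (a * κ ^ l) ^ 2 = κ * κ ^ l * κ ^ l := by
      calc (a * κ ^ l) ^ 2 = a * (κ ^ l * a) * κ ^ l := by rw [pow_two]; simp only [mul_assoc]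
        _ = (a * b) * κ ^ l * κ ^ l := by rw [h1]; simp only [mul_assoc]
        _ = _ := by rw [← hκ]
    have hc0 : Commute κ (κ ^ l) := (Commute.refl κ).zpow_right l
    have hc : Commute κ ((a * κ ^ l) ^ 2) := by
      rw [hx]
      exact ((Commute.refl κ).mul_right hc0).mul_right hc0
    have h2 : κ * (a * κ ^ l) * κ⁻¹ = a * κ ^ l := by
      apply IsMulTorsionFree.pow_left_injective (n := 2) two_ne_zero
      change (κ * (a * κ ^ l) * κ⁻¹) ^ 2 = (a * κ ^ l) ^ 2
      rw [conj_pow, hc.eq, mul_inv_cancel_right]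
    have h3 : Commute κ (a * κ ^ l) := mul_inv_eq_iff_eq_mul.mp h2
    have h4 : Commute κ a := by
      have := h3.mul_right hc0.inv_right
      rwa [mul_inv_cancel_right] at this
    have h5 : b = a := by
      rw [← hl, (h4.zpow_left l).eq, zpow_neg, mul_inv_cancel_right]
    rw [hκ, h5, pow_two]
  · intro h
    refine ⟨0, ?_⟩
    have : a * a = a * b := by rw [← hκ, h, pow_two]
    simpa using mul_left_cancel this
end
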